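/- Let K be a field, S = K[x_1,…,x_n] with n > 2, let I ⊆ S be the ideal generated by the variable x_1 together with a nonempty set E of squarefree monomials of degree 2 in the variables x_2,…,x_n, and let J ⊂ I be a squarefree monomial ideal generated in degrees ≥ 2 with sdepth_S I/J = 2. If there exist indices 1 < i < j ≤ n such that x_1 x_i x_j ∉ J and x_i x_j ∉ I, then depth_S I/J ≤ 2. -/

import Mathlib

open MvPolynomial

/-- The squarefree monomial with support `T` in `K[x_0,…,x_{n-1}]`. -/
noncomputable def sqf (K : Type*) [Field K] (n : ℕ) (T : Finset (Fin n)) :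
    MvPolynomial (Fin n) K :=
  ∏ i ∈ T, X i

/-- The poset `P_{I\J}`: supports of squarefree monomials lying in `I \ J`. -/
def sqfPoset (K : Type*) [Field K] (n : ℕ) (I J : Ideal (MvPolynomial (Fin n) K)) :
    Set (Finset (Fin n)) :=
  {T | sqf K n T ∈ I ∧ sqf K n T ∉ J}

/-- Supports of squarefree monomials of degree `d` lying in `I \ J`. -/
def degSet (K : Type*) [Field K] (n : ℕ) (I J : Ideal (MvPolynomial (Fin n) K)) (d : ℕ) :
    Set (Finset (Fin n)) :=
  {T | T.card = d ∧ T ∈ sqfPoset K n I J}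

/-- A partition of a set `P` of supports of squarefree monomials into intervals
`[u,v] = {w : u ⊆ w ⊆ v}`. -/
structure SqfPartition (n : ℕ) (P : Set (Finset (Fin n))) where
  intervals : Finset (Finset (Fin n) × Finset (Fin n))
  le : ∀ p ∈ intervals, p.1 ⊆ p.2
  ends : ∀ p ∈ intervals, p.1 ∈ P ∧ p.2 ∈ P
  covers : ∀ T ∈ P, ∃ p ∈ intervals, p.1 ⊆ T ∧ T ⊆ p.2
  disj : ∀ p ∈ intervals, ∀ q ∈ intervals, ∀ T : Finset (Fin n),
    p.1 ⊆ T → T ⊆ p.2 → q.1 ⊆ T → T ⊆ q.2 → p = q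

/-- The Stanley depth of a partition: the minimal degree of the upper ends of
its intervals. -/
noncomputable def SqfPartition.sdepth {n : ℕ} {P : Set (Finset (Fin n))}
    (pt : SqfPartition n P) : ℕ :=
  sInf {k | ∃ p ∈ pt.intervals, p.2.card = k}

/-- The Stanley depth of `I/J`: the maximal Stanley depth of a partition of `P_{I\J}`. -/
noncomputable def stanleyDepth (K : Type*) [Field K] (n : ℕ)
    (I J : Ideal (MvPolynomial (Fin n) K)) : ℕ :=
  sSup {k | ∃ pt : SqfPartition n (sqfPoset K n I J), pt.sdepth = k}

/-- The `S`-module `I/J` (for `J ⊆ I` this is the usual quotient). -/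
noncomputable abbrev quotMod (K : Type*) [Field K] (n : ℕ)
    (I J : Ideal (MvPolynomial (Fin n) K)) : Type _ :=
  I ⧸ (Submodule.comap I.subtype J)

/-- The depth of `I/J` over `S = K[x_0,…,x_{n-1}]`: the supremum of lengths of
regular sequences on `I/J` consisting of elements of the maximal graded ideal
`(x_0,…,x_{n-1})`. -/
noncomputable def mdepth (K : Type*) [Field K] (n : ℕ)
    (I J : Ideal (MvPolynomial (Fin n) K)) : ℕ :=
  sSup {k | ∃ rs : List (MvPolynomial (Fin n) K), rs.length = k ∧
    (∀ r ∈ rs, r ∈ Ideal.span (Set.range (X : Fin n → MvPolynomial (Fin n) K))) ∧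
    RingTheory.Sequence.IsRegular (quotMod K n I J) rs}

open RingTheory.Sequence

section KoszulVanishing

variable {R ι M : Type*} [CommRing R] [Fintype ι] [AddCommGroup M] [Module R M]

lemma exists_smul_eq_of_isWeaklyRegular {x : ι → R} {r s : R}
    (hr : r ∈ Ideal.span (Set.range x)) (hs : s ∈ Ideal.span (Set.range x)) {rs : List R}
    (hreg : IsWeaklyRegular M (r :: s :: rs)) (z : ι → M)
    (hz : ∀ p q, x p • z q = x q • z p) : ∃ w, ∀ q, z q = x q • w := by
  obtain ⟨hr', hreg⟩ := (isWeaklyRegular_cons_iff M r _).mp hreg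
  obtain ⟨hs', -⟩ := (isWeaklyRegular_cons_iff _ s _).mp hreg
  obtain ⟨c, rfl⟩ := Ideal.mem_span_range_iff_exists_fun.mp hr
  obtain ⟨d, rfl⟩ := Ideal.mem_span_range_iff_exists_fun.mp hs
  have hw : ∀ q, x q • ∑ k, c k • z k = (∑ k, c k * x k) • z q := by
    intro q
    rw [Finset.smul_sum, Finset.sum_smul]
    refine Finset.sum_congr rfl fun k _ => ?_
    rw [smul_comm, hz q k, smul_smul]
  set w := ∑ k, c k • z k
  set r := ∑ k, c k * x k
  have hkill : ∀ q, x q • (Submodule.Quotient.mk w : QuotSMulTop r M) = 0 := by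
    intro q
    rw [← Submodule.Quotient.mk_smul, Submodule.Quotient.mk_eq_zero, hw]
    exact Submodule.smul_mem_pointwise_smul _ _ _ trivial
  have hzero : (Submodule.Quotient.mk w : QuotSMulTop r M) = 0 := by
    refine hs'.right_eq_zero_of_smul ?_
    rw [Finset.sum_smul]
    exact Finset.sum_eq_zero fun k _ => by rw [← smul_smul, hkill, smul_zero]
  obtain ⟨v, -, hv⟩ := (Submodule.mem_smul_pointwise_iff_exists _ _ _).mp
    ((Submodule.Quotient.mk_eq_zero _).mp hzero)
  refine ⟨v, fun q => hr' ?_⟩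
  change r • z q = r • x q • v
  rw [← hw, ← hv, smul_comm]

lemma exists_coboundary_of_isWeaklyRegular {x : ι → R} {r s t : R}
    (hr : r ∈ Ideal.span (Set.range x)) (hs : s ∈ Ideal.span (Set.range x))
    (ht : t ∈ Ideal.span (Set.range x)) {rs : List R}
    (hreg : IsWeaklyRegular M (r :: s :: t :: rs)) (z : ι → ι → M)
    (hz : ∀ p q k, x p • z q k - x q • z p k + x k • z p q = 0) :
    ∃ w : ι → M, ∀ p q, z p q = x p • w q - x q • w p := by
  obtain ⟨hr', hreg⟩ := (isWeaklyRegular_cons_iff M r _).mp hreg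
  obtain ⟨c, rfl⟩ := Ideal.mem_span_range_iff_exists_fun.mp hr
  let w : ι → M := fun q => ∑ k, c k • z k q
  have hw : ∀ p q, x p • w q - x q • w p = (∑ k, c k * x k) • z p q := by
    intro p q
    simp only [w]
    rw [Finset.smul_sum, Finset.smul_sum, ← Finset.sum_sub_distrib, Finset.sum_smul]
    refine Finset.sum_congr rfl fun k _ => ?_
    rw [smul_comm, smul_comm (x q), ← smul_sub, ← smul_smul]
    congr 1
    rw [← sub_eq_zero, ← neg_eq_zero, ← hz k p q]
    abel
  set r := ∑ k, c k * x k
  obtain ⟨v, hv⟩ := exists_smul_eq_of_isWeaklyRegular hs ht hreg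
    (fun q => (Submodule.Quotient.mk (w q) : QuotSMulTop r M)) (by
      intro p q
      rw [← sub_eq_zero, ← Submodule.Quotient.mk_smul, ← Submodule.Quotient.mk_smul,
        ← Submodule.Quotient.mk_sub, Submodule.Quotient.mk_eq_zero, hw]
      exact Submodule.smul_mem_pointwise_smul _ _ _ trivial)
  obtain ⟨v, rfl⟩ := Submodule.Quotient.mk_surjective _ v
  have hu : ∀ q, ∃ u, r • u = w q - x q • v := by
    intro q
    have h := hv q
    rw [← sub_eq_zero, ← Submodule.Quotient.mk_smul,
        ← Submodule.Quotient.mk_sub, Submodule.Quotient.mk_eq_zero] at h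
    obtain ⟨u, -, hu⟩ := (Submodule.mem_smul_pointwise_iff_exists _ _ _).mp h
    exact ⟨u, hu⟩
  choose u hu using hu
  refine ⟨u, fun p q => hr' ?_⟩
  change r • z p q = r • (x p • u q - x q • u p)
  rw [smul_sub, smul_comm r, smul_comm r, hu, hu, ← hw, smul_sub, smul_sub, smul_comm (x q) (x p)]
  abel

end KoszulVanishing

/-- Fewer triples than pairs: some nonzero alternating function supported on the pairs has
vanishing coboundary on all the triples. -/
lemma exists_alternating_cocycle {K α : Type*} [Field K] [LinearOrder α]
    (B N : Finset (Finset α)) (h : N.card < B.card) (hB : ∀ T ∈ B, T.card = 2)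
    (hN : ∀ T ∈ N, T.card = 3) :
    ∃ a : α → α → K, (∀ p, a p p = 0) ∧ (∀ p q, a p q = - a q p) ∧
      (∀ p q, a p q ≠ 0 → {p, q} ∈ B) ∧ (∃ p q, a p q ≠ 0) ∧
      ∀ p q k, {p, q, k} ∈ N → a q k - a p k + a p q = 0 := by
  let A : (B → K) → α → α → K := fun v p q =>
    (if p < q then 1 else if q < p then -1 else 0) *
      if hpq : {p, q} ∈ B then v ⟨{p, q}, hpq⟩ else 0
  have hdiag : ∀ v p, A v p p = 0 := by intro v p; simp [A]
  have hanti : ∀ v p q, A v p q = - A v q p := by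
    intro v p q
    simp only [A, Finset.pair_comm q p]
    rcases lt_trichotomy p q with hlt | rfl | hlt
    · simp only [hlt, hlt.not_gt, if_true, if_false]; split_ifs <;> ring
    · simp
    · simp only [hlt, hlt.not_gt, if_true, if_false]; split_ifs <;> ring
  have hadd : ∀ v w p q, A (v + w) p q = A v p q + A w p q := by
    intro v w p q
    simp only [A, Pi.add_apply]
    split_ifs <;> ring
  have hsmul : ∀ (c : K) v p q, A (c • v) p q = c * A v p q := by
    intro c v p q
    simp only [A, Pi.smul_apply, smul_eq_mul]
    split_ifs <;> ring
  have henum : ∀ T : N, ∃ p q k, p ≠ q ∧ p ≠ k ∧ q ≠ k ∧ (T : Finset α) = {p, q, k} :=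
    fun T => Finset.card_eq_three.mp (hN T T.2)
  choose e₁ e₂ e₃ he using henum
  let L : (B → K) →ₗ[K] (N → K) :=
    { toFun := fun v T => A v (e₂ T) (e₃ T) - A v (e₁ T) (e₃ T) + A v (e₁ T) (e₂ T)
      map_add' := by intro v w; ext T; simp only [hadd, Pi.add_apply]; ring
      map_smul' := by
        intro c v; ext T
        simp only [hsmul, Pi.smul_apply, smul_eq_mul, RingHom.id_apply]; ring }
  have hker : LinearMap.ker L ≠ ⊥ := LinearMap.ker_ne_bot_of_finrank_lt (by simpa using h)
  obtain ⟨v, hv, hv0⟩ := (Submodule.ne_bot_iff _).mp hker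
  refine ⟨A v, hdiag v, hanti v, ?_, ?_, ?_⟩
  · intro p q hpq
    by_contra hn
    exact hpq (by simp [A, hn])
  · obtain ⟨T, hT⟩ := Function.ne_iff.mp hv0
    obtain ⟨p, q, hpq, hTpq⟩ := Finset.card_eq_two.mp (hB T T.2)
    have hm : {p, q} ∈ B := hTpq ▸ T.2
    have hval : v ⟨{p, q}, hm⟩ ≠ 0 := by
      have : (⟨{p, q}, hm⟩ : B) = T := Subtype.ext hTpq.symm
      rw [this]; exact hT
    refine ⟨p, q, ?_⟩
    simp only [A, hm, dif_pos]
    refine mul_ne_zero ?_ hval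
    rcases lt_or_gt_of_ne hpq with hlt | hlt
    · simp [hlt]
    · simp [hlt, hlt.not_gt]
  · intro p q k hm
    have h0 : L v ⟨_, hm⟩ = 0 := by rw [LinearMap.mem_ker.mp hv]; rfl
    obtain ⟨h12, h13, h23, hset⟩ := he ⟨_, hm⟩
    change A v (e₂ ⟨_, hm⟩) (e₃ ⟨_, hm⟩) - A v (e₁ ⟨_, hm⟩) (e₃ ⟨_, hm⟩)
      + A v (e₁ ⟨_, hm⟩) (e₂ ⟨_, hm⟩) = 0 at h0
    generalize e₁ ⟨_, hm⟩ = x at *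
    generalize e₂ ⟨_, hm⟩ = y at *
    generalize e₃ ⟨_, hm⟩ = z at *
    simp only at hset
    have hx : x = p ∨ x = q ∨ x = k := by
      have : x ∈ ({p, q, k} : Finset α) := by rw [hset]; simp
      simpa using this
    have hy : y = p ∨ y = q ∨ y = k := by
      have : y ∈ ({p, q, k} : Finset α) := by rw [hset]; simp
      simpa using this
    have hz : z = p ∨ z = q ∨ z = k := by
      have : z ∈ ({p, q, k} : Finset α) := by rw [hset]; simp
      simpa using this
    have a1 := hanti v p q
    have a2 := hanti v p k
    have a3 := hanti v q k
    clear hset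
    rcases hx with rfl | rfl | rfl <;> rcases hy with rfl | rfl | rfl <;>
      rcases hz with rfl | rfl | rfl <;>
      first
        | exact absurd rfl h12
        | exact absurd rfl h13
        | exact absurd rfl h23
        | grind

lemma SqfPartition.exists_three_le_sdepth {n : ℕ} {P : Set (Finset (Fin n))} {o i j : Fin n}
    (hoi : o ≠ i) (hoj : o ≠ j) (hij : i ≠ j) (hP : ∀ T ∈ P, T = {o} ∨ 2 ≤ T.card)
    (ho : {o} ∈ P) (hc : {o, i, j} ∈ P) (hb : {i, j} ∉ P)
    (f : {T // T ∈ P ∧ T.card = 2 ∧ T ≠ {o, i} ∧ T ≠ {o, j}} → Finset (Fin n))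
    (hinj : Function.Injective f) (hf : ∀ b, f b ∈ P ∧ (f b).card = 3 ∧ b.1 ⊆ f b) :
    ∃ pt : SqfPartition n P, 3 ≤ pt.sdepth := by
  classical
  have hcard : ({o, i, j} : Finset (Fin n)).card = 3 :=
    Finset.card_eq_three.mpr ⟨o, i, j, hoi, hoj, hij, rfl⟩
  have hsub : ∀ b : {T // T ∈ P ∧ T.card = 2 ∧ T ≠ {o, i} ∧ T ≠ {o, j}},
      ¬ b.1 ⊆ {o, i, j} := by
    rintro ⟨b, hbP, hb2, hbi, hbj⟩ h
    obtain ⟨p, q, hpq, rfl⟩ := Finset.card_eq_two.mp hb2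
    have hp : p = o ∨ p = i ∨ p = j := by
      simpa using h (Finset.mem_insert_self p {q})
    have hq : q = o ∨ q = i ∨ q = j := by
      simpa using h (Finset.mem_insert_of_mem (Finset.mem_singleton_self q))
    rcases hp with rfl | rfl | rfl <;> rcases hq with rfl | rfl | rfl <;>
      first
        | exact hpq rfl
        | exact hbi rfl
        | exact hbj rfl
        | exact hb hbP
        | exact hbi (Finset.pair_comm _ _)
        | exact hbj (Finset.pair_comm _ _)
        | exact hb (by rwa [Finset.pair_comm] at hbP)
  have hmid : ∀ (b : {T // T ∈ P ∧ T.card = 2 ∧ T ≠ {o, i} ∧ T ≠ {o, j}})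
      (T : Finset (Fin n)), b.1 ⊆ T → T ⊆ f b →
      (T = b.1 ∧ T.card = 2) ∨ (T = f b ∧ T.card = 3) := by
    intro b T h1 h2
    have hb2 := b.2.2.1
    have hf3 := (hf b).2.1
    have c1 := Finset.card_le_card h1
    have c2 := Finset.card_le_card h2
    rcases (by lia : T.card = 2 ∨ T.card = 3) with h | h
    · exact Or.inl ⟨(Finset.eq_of_subset_of_card_le h1 (by lia)).symm, h⟩
    · exact Or.inr ⟨Finset.eq_of_subset_of_card_le h2 (by lia), h⟩
  let Q : Finset (Fin n) × Finset (Fin n) → Prop := fun p =>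
    p = ({o}, {o, i, j}) ∨ (∃ b, p = (b.1, f b)) ∨
      (p.1 = p.2 ∧ p.1 ∈ P ∧ 3 ≤ p.1.card ∧ p.1 ≠ {o, i, j} ∧ ∀ b, f b ≠ p.1)
  have hAB : ∀ (b : {T // T ∈ P ∧ T.card = 2 ∧ T ≠ {o, i} ∧ T ≠ {o, j}})
      (T : Finset (Fin n)), T ⊆ {o, i, j} → b.1 ⊆ T → False :=
    fun b T h1 h2 => hsub b (h2.trans h1)
  have hAC : ∀ S : Finset (Fin n), 3 ≤ S.card → S ≠ {o, i, j} → S ⊆ {o, i, j} → False :=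
    fun S h1 h2 h3 => h2 (Finset.eq_of_subset_of_card_le h3 (by lia))
  have hBC : ∀ (b : {T // T ∈ P ∧ T.card = 2 ∧ T ≠ {o, i} ∧ T ≠ {o, j}})
      (S : Finset (Fin n)), 3 ≤ S.card → f b ≠ S → b.1 ⊆ S → S ⊆ f b → False := by
    intro b S h1 h2 h3 h4
    rcases hmid b S h3 h4 with ⟨-, h⟩ | ⟨h, -⟩
    · lia
    · exact h2 h.symm
  refine ⟨⟨Finset.univ.filter Q, ?_, ?_, ?_, ?_⟩, ?_⟩
  · intro p hp
    rcases (Finset.mem_filter.mp hp).2 with rfl | ⟨b, rfl⟩ | ⟨h, -⟩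
    · simp
    · exact (hf b).2.2
    · exact h.subset
  · intro p hp
    rcases (Finset.mem_filter.mp hp).2 with rfl | ⟨b, rfl⟩ | ⟨h, hp, -⟩
    · exact ⟨ho, hc⟩
    · exact ⟨b.2.1, (hf b).1⟩
    · exact ⟨hp, h ▸ hp⟩
  · intro T hT
    by_cases hA : o ∈ T ∧ T ⊆ {o, i, j}
    · exact ⟨({o}, {o, i, j}), by simp [Q], by simpa using hA.1, hA.2⟩
    have h2 : 2 ≤ T.card := by
      rcases hP T hT with rfl | h
      · exact absurd ⟨by simp, by simp⟩ hA
      · exact h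
    rcases h2.eq_or_lt' with h2 | h3
    · have hTi : T ≠ {o, i} := by
        rintro rfl
        exact hA ⟨by simp, by intro x; simp; tauto⟩
      have hTj : T ≠ {o, j} := by
        rintro rfl
        exact hA ⟨by simp, by intro x; simp; tauto⟩
      refine ⟨(T, f ⟨T, hT, h2, hTi, hTj⟩), ?_, subset_rfl, (hf ⟨T, hT, h2, hTi, hTj⟩).2.2⟩
      exact Finset.mem_filter.mpr ⟨Finset.mem_univ _, Or.inr (Or.inl ⟨⟨T, hT, h2, hTi, hTj⟩, rfl⟩)⟩
    · by_cases hfT : ∃ b, f b = T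
      · obtain ⟨b, rfl⟩ := hfT
        exact ⟨(b.1, f b), Finset.mem_filter.mpr ⟨Finset.mem_univ _, Or.inr (Or.inl ⟨_, rfl⟩)⟩,
          (hf b).2.2, subset_rfl⟩
      · push Not at hfT
        refine ⟨(T, T), Finset.mem_filter.mpr ⟨Finset.mem_univ _, Or.inr (Or.inr
          ⟨rfl, hT, h3, ?_, hfT⟩)⟩, subset_rfl, subset_rfl⟩
        rintro rfl
        exact hA ⟨by simp, subset_rfl⟩
  · rintro ⟨p₁, p₂⟩ hp ⟨q₁, q₂⟩ hq T hp1 hp2 hq1 hq2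
    replace hp := (Finset.mem_filter.mp hp).2
    replace hq := (Finset.mem_filter.mp hq).2
    simp only [Q, Prod.mk.injEq] at hp hq hp1 hp2 hq1 hq2
    rcases hp with ⟨rfl, rfl⟩ | ⟨b, rfl, rfl⟩ | ⟨rfl, hpP, hp3, hpc, hpf⟩ <;>
      rcases hq with ⟨rfl, rfl⟩ | ⟨b', rfl, rfl⟩ | ⟨rfl, hqP, hq3, hqc, hqf⟩
    · rfl
    · exact (hAB _ _ hp2 hq1).elim
    · exact (hAC _ hq3 hqc (hq1.trans hp2)).elim
    · exact (hAB _ _ hq2 hp1).elim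
    · rcases hmid b T hp1 hp2 with ⟨h, h'⟩ | ⟨h, h'⟩ <;>
        rcases hmid b' T hq1 hq2 with ⟨k, k'⟩ | ⟨k, k'⟩
      · rw [Subtype.ext (h.symm.trans k)]
      · lia
      · lia
      · rw [hinj (h.symm.trans k)]
    · exact (hBC b _ hq3 (hqf b) (hp1.trans hq2) (hq1.trans hp2)).elim
    · exact (hAC _ hp3 hpc (hp1.trans hq2)).elim
    · exact (hBC b' _ hp3 (hpf b') (hq1.trans hp2) (hp1.trans hq2)).elim
    · rw [hp1.antisymm hp2, hq1.antisymm hq2]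
  · refine le_csInf ⟨3, ({o}, {o, i, j}), by simp [Q], hcard⟩ ?_
    rintro k ⟨p, hp, rfl⟩
    rcases (Finset.mem_filter.mp hp).2 with rfl | ⟨b, rfl⟩ | ⟨h, -, h3, -⟩
    · exact hcard.ge
    · exact (hf b).2.1.ge
    · exact h ▸ h3

lemma SqfPartition.sdepth_le {n : ℕ} {P : Set (Finset (Fin n))} (pt : SqfPartition n P) :
    pt.sdepth ≤ n := by
  rcases Set.eq_empty_or_nonempty {k | ∃ p ∈ pt.intervals, p.2.card = k} with h | h
  · rw [SqfPartition.sdepth, h, Nat.sInf_empty]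
    exact Nat.zero_le n
  · obtain ⟨p, -, hp⟩ := Nat.sInf_mem h
    change _ = pt.sdepth at hp
    rw [← hp]
    simpa using Finset.card_le_univ p.2

lemma SqfPartition.sdepth_le_stanleyDepth {K : Type*} [Field K] {n : ℕ}
    {I J : Ideal (MvPolynomial (Fin n) K)} (pt : SqfPartition n (sqfPoset K n I J)) :
    pt.sdepth ≤ stanleyDepth K n I J :=
  le_csSup ⟨n, by rintro k ⟨pt, rfl⟩; exact pt.sdepth_le⟩ ⟨pt, rfl⟩

/-- The exponent vector of the squarefree monomial with support `T`. -/
noncomputable def sqfExponent {n : ℕ} (T : Finset (Fin n)) : Fin n →₀ ℕ :=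
  ∑ i ∈ T, Finsupp.single i 1

lemma sqfExponent_apply {n : ℕ} (T : Finset (Fin n)) (i : Fin n) :
    sqfExponent T i = if i ∈ T then 1 else 0 := by
  simp [sqfExponent, Finsupp.finsetSum_apply, Finsupp.single_apply]

lemma sqfExponent_le_iff {n : ℕ} {T U : Finset (Fin n)} :
    sqfExponent T ≤ sqfExponent U ↔ T ⊆ U := by
  constructor
  · intro h i hi
    have := h i
    simp only [sqfExponent_apply, hi, if_true] at this
    by_contra hU
    simp [hU] at this
  · intro h i
    simp only [sqfExponent_apply]
    split_ifs with h1 h2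
    · rfl
    · exact absurd (h h1) h2
    · exact Nat.zero_le _
    · rfl

lemma sqf_eq_monomial (K : Type*) [Field K] {n : ℕ} (T : Finset (Fin n)) :
    sqf K n T = monomial (sqfExponent T) 1 := by
  rw [sqfExponent, monomial_sum_one]
  rfl

lemma exists_subset_of_coeff_ne_zero {K : Type*} [Field K] {n : ℕ} {G : Set (Finset (Fin n))}
    {g : MvPolynomial (Fin n) K} (hg : g ∈ Ideal.span (sqf K n '' G)) {T : Finset (Fin n)}
    (hT : coeff (sqfExponent T) g ≠ 0) : ∃ U ∈ G, U ⊆ T := by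
  have himage : sqf K n '' G = (fun s => monomial s (1 : K)) '' (sqfExponent '' G) := by
    rw [Set.image_image]
    exact Set.image_congr fun T _ => sqf_eq_monomial K T
  rw [himage, mem_ideal_span_monomial_image] at hg
  obtain ⟨_, ⟨U, hU, rfl⟩, h⟩ := hg _ (mem_support_iff.mpr hT)
  exact ⟨U, hU, sqfExponent_le_iff.mp h⟩

lemma sqf_mem_span_iff {K : Type*} [Field K] {n : ℕ} {G : Set (Finset (Fin n))}
    {T : Finset (Fin n)} : sqf K n T ∈ Ideal.span (sqf K n '' G) ↔ ∃ U ∈ G, U ⊆ T := by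
  constructor
  · intro h
    exact exists_subset_of_coeff_ne_zero h (by simp [sqf_eq_monomial])
  · rintro ⟨U, hU, h⟩
    exact Ideal.mem_of_dvd _ (Finset.prod_dvd_prod_of_subset _ _ _ h)
      (Ideal.subset_span ⟨U, hU, rfl⟩)

lemma coeff_eq_zero_of_sqf_notMem {K : Type*} [Field K] {n : ℕ} {G : Set (Finset (Fin n))}
    {g : MvPolynomial (Fin n) K} (hg : g ∈ Ideal.span (sqf K n '' G)) {T : Finset (Fin n)}
    (hT : sqf K n T ∉ Ideal.span (sqf K n '' G)) : coeff (sqfExponent T) g = 0 := by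
  by_contra h
  exact hT (sqf_mem_span_iff.mpr (exists_subset_of_coeff_ne_zero hg h))

lemma sqf_singleton (K : Type*) [Field K] {n : ℕ} (p : Fin n) : sqf K n {p} = X p := by
  simp [sqf]

lemma sqf_pair (K : Type*) [Field K] {n : ℕ} {p q : Fin n} (h : p ≠ q) :
    sqf K n {p, q} = X p * X q := by
  simp [sqf, Finset.prod_pair h]

lemma sqf_triple (K : Type*) [Field K] {n : ℕ} {p q k : Fin n} (h₁ : p ≠ q) (h₂ : p ≠ k)
    (h₃ : q ≠ k) : sqf K n {p, q, k} = X p * X q * X k := by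
  rw [sqf, Finset.prod_insert (by simp [h₁, h₂]), Finset.prod_pair h₃, mul_assoc]

lemma sqfExponent_pair {n : ℕ} {p q : Fin n} (h : p ≠ q) :
    sqfExponent {p, q} = Finsupp.single p 1 + sqfExponent {q} := by
  simp [sqfExponent, Finset.sum_pair h]

lemma mdepth_le_two_of_cocycle {K : Type*} [Field K] {n : ℕ} {F G : Set (Finset (Fin n))}
    {I J : Ideal (MvPolynomial (Fin n) K)} (hI : I = Ideal.span (sqf K n '' F))
    (hJ : J = Ideal.span (sqf K n '' G)) {o i : Fin n} (hF : ∀ T ∈ F, T = {o} ∨ 2 ≤ T.card)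
    (hoi : o ≠ i) (hoiJ : sqf K n {o, i} ∉ J) (a : Fin n → Fin n → K)
    (hdiag : ∀ p, a p p = 0) (hanti : ∀ p q, a p q = - a q p)
    (hsupp : ∀ p q, a p q ≠ 0 → {p, q} ∈ sqfPoset K n I J) (hne : ∃ p q, a p q ≠ 0)
    (ha : a o i = 0)
    (hcoc : ∀ p q k, p ≠ q → p ≠ k → q ≠ k → sqf K n {p, q, k} ∉ J →
      a q k - a p k + a p q = 0) : mdepth K n I J ≤ 2 := by
  refine csSup_le' ?_
  rintro _ ⟨rs, rfl, hrs, hreg⟩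
  by_contra! hlen
  obtain ⟨r, s, t, rs, rfl⟩ : ∃ r s t rs', rs = r :: s :: t :: rs' := by
    match rs, hlen with
    | r :: s :: t :: rs', _ => exact ⟨r, s, t, rs', rfl⟩
  have hmem : ∀ p q, C (a p q) * (X p * X q) ∈ I := by
    intro p q
    by_cases hpq : p = q
    · subst hpq; simp [hdiag]
    by_cases h0 : a p q = 0
    · simp [h0]
    · rw [← sqf_pair K hpq]
      exact I.mul_mem_left _ (hsupp p q h0).1
  let z : Fin n → Fin n → quotMod K n I J := fun p q =>
    Submodule.Quotient.mk ⟨C (a p q) * (X p * X q), hmem p q⟩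
  obtain ⟨w, hw⟩ := exists_coboundary_of_isWeaklyRegular (M := quotMod K n I J) (x := X)
    (hrs r (by simp)) (hrs s (by simp)) (hrs t (by simp)) hreg.toIsWeaklyRegular z (by
      intro p q k
      simp only [z, ← Submodule.Quotient.mk_smul, ← Submodule.Quotient.mk_sub,
        ← Submodule.Quotient.mk_add]
      rw [Submodule.Quotient.mk_eq_zero, Submodule.mem_comap]
      simp only [Submodule.subtype_apply, Submodule.coe_add, Submodule.coe_sub,
        Submodule.coe_smul, smul_eq_mul]
      have hrw : X p * (C (a q k) * (X q * X k)) - X q * (C (a p k) * (X p * X k)) +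
          X k * (C (a p q) * (X p * X q)) =
          C (a q k - a p k + a p q) * (X p * X q * X k : MvPolynomial (Fin n) K) := by
        rw [C_add, C_sub]; ring
      rw [hrw]
      by_cases h1 : p = q
      · subst h1; simp [hdiag]
      by_cases h2 : p = k
      · subst h2; rw [hanti p q, hdiag]; simp
      by_cases h3 : q = k
      · subst h3; simp [hdiag]
      by_cases hT : sqf K n {p, q, k} ∈ J
      · rw [← sqf_triple K h1 h2 h3]
        exact J.mul_mem_left _ hT
      · simp [hcoc p q k h1 h2 h3 hT])
  choose y hy using fun q => Submodule.Quotient.mk_surjective _ (w q)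
  have hcoeff : ∀ p q, p ≠ q → sqf K n {p, q} ∉ J →
      a p q = coeff (sqfExponent {q}) (y q : MvPolynomial (Fin n) K) -
        coeff (sqfExponent {p}) (y p : MvPolynomial (Fin n) K) := by
    intro p q hpq hT
    have h := hw p q
    rw [← hy, ← hy, ← sub_eq_zero] at h
    simp only [z, ← Submodule.Quotient.mk_smul, ← Submodule.Quotient.mk_sub] at h
    rw [Submodule.Quotient.mk_eq_zero, Submodule.mem_comap] at h
    simp only [Submodule.subtype_apply, Submodule.coe_sub, Submodule.coe_smul,
      smul_eq_mul] at h
    rw [hJ] at h hT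
    have h0 := coeff_eq_zero_of_sqf_notMem h hT
    rw [coeff_sub, coeff_sub, ← sqf_pair K hpq, coeff_C_mul, sqf_eq_monomial, coeff_monomial,
      if_pos rfl, mul_one, sub_eq_zero] at h0
    rw [h0]
    congr 1
    · rw [sqfExponent_pair hpq, coeff_X_mul]
    · rw [Finset.pair_comm, sqfExponent_pair hpq.symm, coeff_X_mul]
  have hzero : ∀ q, q ≠ o → coeff (sqfExponent {q}) (y q : MvPolynomial (Fin n) K) = 0 := by
    intro q hq
    refine coeff_eq_zero_of_sqf_notMem (G := F) (by rw [← hI]; exact (y q).2) ?_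
    rw [sqf_mem_span_iff]
    rintro ⟨U, hU, hUq⟩
    rcases hF U hU with rfl | h
    · exact hq (Finset.mem_singleton.mp (hUq (Finset.mem_singleton_self o))).symm
    · have := Finset.card_le_card hUq
      rw [Finset.card_singleton] at this
      lia
  have hall : ∀ q, coeff (sqfExponent {q}) (y q : MvPolynomial (Fin n) K) = 0 := by
    intro q
    by_cases hq : q = o
    · have := hcoeff o i hoi hoiJ
      rw [ha, hzero i hoi.symm, zero_sub, eq_comm, neg_eq_zero] at this
      rwa [hq]
    · exact hzero q hq
  obtain ⟨p, q, hpq⟩ := hne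
  refine hpq ?_
  rw [hcoeff p q (fun h => hpq (h ▸ hdiag p)) (hsupp p q hpq).2, hall, hall, sub_zero]

/-- The first case in the proof of **Theorem 1.10**. -/
theorem stmt11 (n : ℕ) [NeZero n] (hn : 2 < n) (K : Type*) [Field K]
    (I J : Ideal (MvPolynomial (Fin n) K))
    (E : Set (Finset (Fin n))) (hE : E.Nonempty)
    (hEdeg : ∀ T ∈ E, T.card = 2 ∧ (0 : Fin n) ∉ T)
    (hI : I = Ideal.span ({X (0 : Fin n)} ∪ sqf K n '' E))
    (hJI : J < I)
    (hJ : ∃ G : Set (Finset (Fin n)), (∀ T ∈ G, 2 ≤ T.card) ∧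
      J = Ideal.span (sqf K n '' G))
    (hsd : stanleyDepth K n I J = 2)
    (i j : Fin n) (hi : 0 < (i : ℕ)) (hij : (i : ℕ) < (j : ℕ))
    (hc : X (0 : Fin n) * X i * X j ∉ J)
    (hb : X i * X j ∉ I) :
    mdepth K n I J ≤ 2 := by
  classical
  obtain ⟨G, hG, hJG⟩ := hJ
  set o : Fin n := 0
  have hoi : o ≠ i := by rintro rfl; simp [o] at hi
  have hoj : o ≠ j := by rintro rfl; simp [o] at hij
  have hij' : i ≠ j := by rintro rfl; exact lt_irrefl _ hij
  rw [← sqf_triple K hoi hoj hij'] at hc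
  rw [← sqf_pair K hij'] at hb
  have hIF : I = Ideal.span (sqf K n '' ({{o}} ∪ E)) := by
    rw [hI, Set.image_union, Set.image_singleton, sqf_singleton]
  have hF : ∀ T ∈ ({{o}} ∪ E : Set (Finset (Fin n))), T = {o} ∨ 2 ≤ T.card := by
    rintro T (hT | hT)
    · exact Or.inl hT
    · exact Or.inr (hEdeg T hT).1.ge
  have hJmono : ∀ T U : Finset (Fin n), T ⊆ U → sqf K n U ∉ J → sqf K n T ∉ J :=
    fun T U h hU hT => hU (Ideal.mem_of_dvd _ (Finset.prod_dvd_prod_of_subset _ _ _ h) hT)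
  have hImono : ∀ T U : Finset (Fin n), T ⊆ U → sqf K n T ∈ I → sqf K n U ∈ I :=
    fun T U h hT => Ideal.mem_of_dvd _ (Finset.prod_dvd_prod_of_subset _ _ _ h) hT
  have hoI : sqf K n {o} ∈ I := by
    rw [hIF]; exact Ideal.subset_span ⟨{o}, Or.inl rfl, rfl⟩
  have hP : ∀ T ∈ sqfPoset K n I J, T = {o} ∨ 2 ≤ T.card := by
    rintro T ⟨hT, -⟩
    rw [hIF, sqf_mem_span_iff] at hT
    obtain ⟨U, hU, hUT⟩ := hT
    have hle := Finset.card_le_card hUT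
    rcases hF U hU with rfl | h
    · rw [Finset.card_singleton] at hle
      rcases hle.eq_or_lt with h | h
      · exact Or.inl (Finset.eq_of_subset_of_card_le hUT (by simp [← h])).symm
      · exact Or.inr h
    · exact Or.inr (h.trans hle)
  let ι := {T // T ∈ sqfPoset K n I J ∧ T.card = 2 ∧ T ≠ {o, i} ∧ T ≠ {o, j}}
  let N : ι → Finset (Finset (Fin n)) := fun b =>
    Finset.univ.filter fun T => T ∈ sqfPoset K n I J ∧ T.card = 3 ∧ b.1 ⊆ T
  have hHall : ¬ ∀ s : Finset ι, s.card ≤ (s.biUnion N).card := by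
    rw [Finset.all_card_le_biUnion_card_iff_exists_injective]
    rintro ⟨f, hinj, hf⟩
    obtain ⟨pt, hpt⟩ := SqfPartition.exists_three_le_sdepth hoi hoj hij' hP
      ⟨hoI, hJmono _ _ (by simp) hc⟩ ⟨hImono {o} _ (by simp) hoI, hc⟩ (fun h => hb h.1) f hinj
      (fun b => (Finset.mem_filter.mp (hf b)).2)
    have := pt.sdepth_le_stanleyDepth
    lia
  push Not at hHall
  obtain ⟨s, hs⟩ := hHall
  obtain ⟨a, hdiag, hanti, hsupp, hne, hcoc⟩ := exists_alternating_cocycle (K := K)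
    (s.map (Function.Embedding.subtype _)) (s.biUnion N) (by rwa [Finset.card_map])
    (by
      intro T hT
      obtain ⟨b, -, rfl⟩ := Finset.mem_map.mp hT
      exact b.2.2.1)
    (by
      intro T hT
      obtain ⟨b, -, hb⟩ := Finset.mem_biUnion.mp hT
      exact (Finset.mem_filter.mp hb).2.2.1)
  replace hsupp : ∀ p q, a p q ≠ 0 → ∃ b ∈ s, b.1 = {p, q} :=
    fun p q h => Finset.mem_map.mp (hsupp p q h)
  refine mdepth_le_two_of_cocycle hIF hJG hF hoi (hJmono _ _ ?_ hc) a hdiag hanti ?_ hne ?_ ?_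
  · intro x; simp; tauto
  · intro p q h
    obtain ⟨b, -, hb⟩ := hsupp p q h
    exact hb ▸ b.2.1
  · by_contra h
    obtain ⟨b, -, hb⟩ := hsupp o i h
    exact b.2.2.2.1 hb
  · intro p q k hpq hpk hqk hT
    by_cases hm : {p, q, k} ∈ s.biUnion N
    · exact hcoc p q k hm
    have hvanish : ∀ u v, ({u, v} : Finset (Fin n)) ⊆ {p, q, k} → a u v = 0 := by
      intro u v huv
      by_contra h
      obtain ⟨b, hbs, hb⟩ := hsupp u v h
      rw [← hb] at huv
      exact hm (Finset.mem_biUnion.mpr ⟨b, hbs, Finset.mem_filter.mpr ⟨Finset.mem_univ _,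
        ⟨hImono _ _ huv b.2.1.1, hT⟩, Finset.card_eq_three.mpr ⟨p, q, k, hpq, hpk, hqk, rfl⟩,
        huv⟩⟩)
    rw [hvanish q k (by intro x; simp; tauto), hvanish p k (by intro x; simp; tauto),
      hvanish p q (by intro x; simp; tauto)]
    simp
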